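/- arXiv:1908.01289 — 2 statements merged into one kernel-verified Lean document; each statement's English description precedes it below -/
import Mathlib

section
/- Let d ∈ ℕ with d ≥ 1, let λ ≥ 1, and let S be a finite subset of ℝ^d. Then there exists a constant b < ∞ such that for every n ∈ ℕ, every sequence of feature vectors x_1, …, x_n ∈ S, and every sequence of labels y_1, …, y_n ∈ {−1/2, 1/2}, the unique minimizer r̂ over r ∈ ℝ^d of the ridge-regression objective r ↦ Σ_{i=1}^n (x_i · r − y_i)^2 + λ‖r‖_2^2 satisfies ‖r̂‖_2 ≤ b. That is, the ridge-regression (MAP) estimates are bounded uniformly in n, the choice of feature vectors from S, and the labels. -/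
open Matrix Finset
open scoped InnerProductSpace

/-- The orthogonal projection of `r` onto the span of a finite set `A` is controlled by the
inner products of `r` with the elements of `A`. -/
theorem exists_norm_starProjection_span_le {E : Type*} [NormedAddCommGroup E]
    [InnerProductSpace ℝ E] [FiniteDimensional ℝ E] (A : Finset E) :
    ∃ K : ℝ, 0 ≤ K ∧ ∀ (r : E) (t : ℝ), 0 ≤ t → (∀ s ∈ A, |⟪s, r⟫_ℝ| ≤ t) →
      ‖(Submodule.span ℝ (A : Set E)).starProjection r‖ ≤ K * t := by
  set U := Submodule.span ℝ (A : Set E)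
  let L : U →ₗ[ℝ] (A → ℝ) := LinearMap.pi fun s => (innerₛₗ ℝ (s : E)) ∘ₗ U.subtype
  have hL : ∀ w s, L w s = ⟪(s : E), (w : E)⟫_ℝ := fun w s => rfl
  have hker : LinearMap.ker L = ⊥ := by
    refine LinearMap.ker_eq_bot'.2 fun w hw => ?_
    have hle : U ≤ LinearMap.ker (innerₛₗ ℝ (w : E)) := by
      refine Submodule.span_le.2 fun s hs => ?_
      have h := congrFun hw ⟨s, hs⟩
      rw [hL] at h
      simpa [real_inner_comm] using h
    have h : ⟪(w : E), (w : E)⟫_ℝ = 0 := hle w.2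
    exact Subtype.ext (inner_self_eq_zero.1 h)
  obtain ⟨K, -, hK⟩ := L.exists_antilipschitzWith hker
  refine ⟨K, K.2, fun r t ht h => ?_⟩
  have hw := hK.le_mul_norm_sub (U.orthogonalProjectionOnto r) 0
  rw [map_zero, add_zero, add_zero, norm_neg, norm_neg] at hw
  refine hw.trans (mul_le_mul_of_nonneg_left ?_ K.2)
  refine (pi_norm_le_iff_of_nonneg ht).2 fun s => ?_
  have hs : (s : E) ∈ U := Submodule.subset_span s.2
  have he : ⟪(s : E), U.starProjection r⟫_ℝ = ⟪(s : E), r⟫_ℝ := by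
    rw [← Submodule.inner_starProjection_left_eq_right,
      Submodule.starProjection_eq_self_iff.2 hs]
  rw [hL, Real.norm_eq_abs]
  exact he ▸ h s s.2

/-- A vector `r` is bounded, uniformly in terms of `S` and `c`, as soon as `⟪v, r⟫ ≤ 0` for every
`v` which is orthogonal to the `s ∈ S` with `|⟪s, r⟫| ≤ c` and which lies on the same side as `r`
of the hyperplanes orthogonal to the elements of `S`. -/
theorem exists_norm_le_of_forall_inner_nonpos {E : Type*} [NormedAddCommGroup E]
    [InnerProductSpace ℝ E] [FiniteDimensional ℝ E] (S : Finset E) (c : ℝ) (hc : 0 ≤ c) :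
    ∃ b : ℝ, ∀ r : E,
      (∀ v : E, (∀ s ∈ S, |⟪s, r⟫_ℝ| ≤ c → ⟪s, v⟫_ℝ = 0) →
        (∀ s ∈ S, 0 ≤ ⟪s, r⟫_ℝ * ⟪s, v⟫_ℝ) → ⟪v, r⟫_ℝ ≤ 0) → ‖r‖ ≤ b := by
  classical
  suffices H : ∀ B A : Finset E, S ⊆ A ∪ B → ∀ t : ℝ, c ≤ t → ∃ b : ℝ, ∀ r : E,
      (∀ v : E, (∀ s ∈ S, |⟪s, r⟫_ℝ| ≤ c → ⟪s, v⟫_ℝ = 0) →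
        (∀ s ∈ S, 0 ≤ ⟪s, r⟫_ℝ * ⟪s, v⟫_ℝ) → ⟪v, r⟫_ℝ ≤ 0) →
      (∀ s ∈ A, |⟪s, r⟫_ℝ| ≤ t) → ‖r‖ ≤ b by
    obtain ⟨b, hb⟩ := H S ∅ (by simp) c le_rfl
    exact ⟨b, fun r hr => hb r hr (by simp)⟩
  intro B
  induction B using Finset.strongInduction with
  | H B ih =>
  intro A hS t hct
  have ht : 0 ≤ t := hc.trans hct
  obtain ⟨K, hK0, hK⟩ := exists_norm_starProjection_span_le A
  set U := Submodule.span ℝ (A : Set E)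
  set M : ℝ := ∑ s ∈ S, ‖s‖
  set t' : ℝ := max t (M * (K * t))
  have hstep : ∀ s : E, ∃ b : ℝ, s ∈ B → ∀ r : E,
      (∀ v : E, (∀ s ∈ S, |⟪s, r⟫_ℝ| ≤ c → ⟪s, v⟫_ℝ = 0) →
        (∀ s ∈ S, 0 ≤ ⟪s, r⟫_ℝ * ⟪s, v⟫_ℝ) → ⟪v, r⟫_ℝ ≤ 0) →
      (∀ s' ∈ insert s A, |⟪s', r⟫_ℝ| ≤ t') → ‖r‖ ≤ b := by
    intro s
    by_cases hs : s ∈ B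
    · obtain ⟨b, hb⟩ := ih (B.erase s) (Finset.erase_ssubset hs) (insert s A)
        (fun x hx => by
          have := hS hx
          by_cases hxs : x = s <;> simp_all) t' (hct.trans (le_max_left _ _))
      exact ⟨b, fun _ => hb⟩
    · exact ⟨0, fun h => absurd h hs⟩
  choose b hb using hstep
  refine ⟨K * t + ∑ s ∈ B, |b s|, fun r hr hA => ?_⟩
  have hsum : 0 ≤ ∑ s ∈ B, |b s| := Finset.sum_nonneg fun _ _ => abs_nonneg _
  by_cases hex : ∃ s ∈ B, |⟪s, r⟫_ℝ| ≤ t'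
  · obtain ⟨s, hs, hst⟩ := hex
    have h1 : ‖r‖ ≤ b s := hb s hs r hr fun s' hs' => by
      rcases Finset.mem_insert.1 hs' with rfl | h
      · exact hst
      · exact (hA s' h).trans (le_max_left _ _)
    have h2 : |b s| ≤ ∑ s ∈ B, |b s| :=
      Finset.single_le_sum (f := fun s => |b s|) (fun _ _ => abs_nonneg _) hs
    have h3 := le_abs_self (b s)
    have h4 : 0 ≤ K * t := mul_nonneg hK0 ht
    linarith
  · push Not at hex
    have hP := hK r t ht hA
    have hv : ∀ s ∈ A, ⟪s, r - U.starProjection r⟫_ℝ = 0 := fun s hs =>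
      (Submodule.mem_orthogonal _ _).1 (Submodule.sub_starProjection_mem_orthogonal r) s
        (Submodule.subset_span hs)
    have hle : ⟪r - U.starProjection r, r⟫_ℝ ≤ 0 := by
      refine hr _ (fun s hs hsc => ?_) (fun s hs => ?_)
      · rcases Finset.mem_union.1 (hS hs) with h | h
        · exact hv s h
        · exact absurd (hex s h) (not_lt.2 (hsc.trans (hct.trans (le_max_left _ _))))
      · rcases Finset.mem_union.1 (hS hs) with h | h
        · rw [hv s h, mul_zero]
        · have h1 : |⟪s, U.starProjection r⟫_ℝ| ≤ |⟪s, r⟫_ℝ| := by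
            calc |⟪s, U.starProjection r⟫_ℝ| ≤ ‖s‖ * ‖U.starProjection r‖ :=
                  abs_real_inner_le_norm _ _
              _ ≤ M * (K * t) := by
                  gcongr
                  exact Finset.single_le_sum (f := fun s : E => ‖s‖)
                    (fun _ _ => norm_nonneg _) hs
              _ ≤ |⟪s, r⟫_ℝ| := (le_max_right _ _).trans (hex s h).le
          have h2 := mul_le_mul_of_nonneg_left h1 (abs_nonneg ⟪s, r⟫_ℝ)
          rw [← abs_mul, abs_mul_abs_self] at h2
          rw [inner_sub_right, mul_sub]
          linarith [le_abs_self (⟪s, r⟫_ℝ * ⟪s, U.starProjection r⟫_ℝ)]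
    have horth : ⟪r - U.starProjection r, U.starProjection r⟫_ℝ = 0 := by
      rw [real_inner_comm]
      exact (Submodule.mem_orthogonal _ _).1 (Submodule.sub_starProjection_mem_orthogonal r) _
        (Submodule.starProjection_apply_mem _ _)
    have h0 : r - U.starProjection r = 0 := by
      rw [← real_inner_self_nonpos, inner_sub_right, horth, sub_zero]
      exact hle
    rw [← sub_eq_zero.1 h0] at hP
    linarith

/-- The first order optimality condition for the ridge regression objective. -/
theorem ridge_regression_normal_equation {ι κ : Type*} [Fintype ι] [Fintype κ] (lam : ℝ)
    (x : ι → κ → ℝ) (y : ι → ℝ) (rhat : κ → ℝ)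
    (hmin : ∀ r : κ → ℝ,
      (∑ i, (x i ⬝ᵥ rhat - y i) ^ 2) + lam * ∑ j, rhat j ^ 2 ≤
      (∑ i, (x i ⬝ᵥ r - y i) ^ 2) + lam * ∑ j, r j ^ 2) (v : κ → ℝ) :
    ∑ i, (x i ⬝ᵥ rhat - y i) * (x i ⬝ᵥ v) + lam * (rhat ⬝ᵥ v) = 0 := by
  set q := ∑ i, (x i ⬝ᵥ rhat - y i) * (x i ⬝ᵥ v) + lam * (rhat ⬝ᵥ v) with hq
  have key : ∀ ε : ℝ, 0 ≤ (∑ i, (x i ⬝ᵥ v) ^ 2 + lam * ∑ j, v j ^ 2) * (ε * ε)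
      + (2 * q) * ε + 0 := by
    intro ε
    have h := hmin (rhat + ε • v)
    have e1 : ∑ i, (x i ⬝ᵥ (rhat + ε • v) - y i) ^ 2 = ∑ i, (x i ⬝ᵥ rhat - y i) ^ 2
        + 2 * ε * ∑ i, (x i ⬝ᵥ rhat - y i) * (x i ⬝ᵥ v) + ε ^ 2 * ∑ i, (x i ⬝ᵥ v) ^ 2 := by
      rw [Finset.mul_sum, Finset.mul_sum, ← Finset.sum_add_distrib, ← Finset.sum_add_distrib]
      refine Finset.sum_congr rfl fun i _ => ?_
      rw [dotProduct_add, dotProduct_smul, smul_eq_mul]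
      ring
    have e2 : ∑ j, (rhat + ε • v) j ^ 2 = ∑ j, rhat j ^ 2
        + 2 * ε * (rhat ⬝ᵥ v) + ε ^ 2 * ∑ j, v j ^ 2 := by
      rw [dotProduct, Finset.mul_sum, Finset.mul_sum, ← Finset.sum_add_distrib,
        ← Finset.sum_add_distrib]
      refine Finset.sum_congr rfl fun j _ => ?_
      rw [Pi.add_apply, Pi.smul_apply, smul_eq_mul]
      ring
    rw [e1, e2] at h
    rw [hq]
    linarith
  have := discrim_le_zero key
  rw [discrim] at this
  nlinarith [sq_nonneg q]

/-- the ridge-regression (MAP) estimates are bounded uniformly in the number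
of observations `n`, the choice of feature vectors from the finite set `S`, and the
labels `y i ∈ {-1/2, 1/2}`. -/
theorem ridge_regression_minimizer_bounded
    (d : ℕ) (hd : 1 ≤ d) (lam : ℝ) (hlam : 1 ≤ lam)
    (S : Finset (Fin d → ℝ)) :
    ∃ b : ℝ, ∀ (n : ℕ) (x : Fin n → Fin d → ℝ), (∀ i, x i ∈ S) →
      ∀ (y : Fin n → ℝ), (∀ i, y i = -(1/2) ∨ y i = 1/2) →
      ∀ rhat : Fin d → ℝ,
        (∀ r : Fin d → ℝ,
          (∑ i, (x i ⬝ᵥ rhat - y i) ^ 2) + lam * ∑ j, rhat j ^ 2 ≤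
          (∑ i, (x i ⬝ᵥ r - y i) ^ 2) + lam * ∑ j, r j ^ 2) →
        Real.sqrt (∑ j, rhat j ^ 2) ≤ b := by
  classical
  have hinner : ∀ u w : Fin d → ℝ, ⟪WithLp.toLp 2 u, WithLp.toLp 2 w⟫_ℝ = u ⬝ᵥ w := fun u w => by
    rw [EuclideanSpace.inner_toLp_toLp, star_trivial, dotProduct_comm]
  obtain ⟨b, hb⟩ := exists_norm_le_of_forall_inner_nonpos
    (S.image fun s => (WithLp.toLp 2 s : EuclideanSpace ℝ (Fin d))) (1 / 2) (by norm_num)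
  refine ⟨b, fun n x hx y hy rhat hmin => ?_⟩
  have hnorm : Real.sqrt (∑ j, rhat j ^ 2) = ‖(WithLp.toLp 2 rhat : EuclideanSpace ℝ (Fin d))‖ := by
    simp [EuclideanSpace.norm_eq]
  rw [hnorm]
  refine hb _ fun v hv0 hv => ?_
  obtain ⟨v, rfl⟩ := (WithLp.toLp_surjective 2) v
  simp only [Finset.forall_mem_image, hinner] at hv0 hv ⊢
  have hq := ridge_regression_normal_equation lam x y rhat hmin v
  have hnonneg : 0 ≤ ∑ i, (x i ⬝ᵥ rhat - y i) * (x i ⬝ᵥ v) := by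
    refine Finset.sum_nonneg fun i _ => ?_
    have h0 := hv0 (hx i)
    have h1 := hv (hx i)
    by_cases hs : |x i ⬝ᵥ rhat| ≤ 1 / 2
    · rw [h0 hs, mul_zero]
    · rcases lt_abs.1 (not_le.1 hs) with h | h
      · have h2 : 0 ≤ x i ⬝ᵥ v := nonneg_of_mul_nonneg_right h1 (by linarith)
        exact mul_nonneg (by rcases hy i with h | h <;> linarith) h2
      · have h2 : x i ⬝ᵥ v ≤ 0 := by
          by_contra! h3
          nlinarith
        exact mul_nonneg_of_nonpos_of_nonpos (by rcases hy i with h | h <;> linarith) h2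
  rw [dotProduct_comm]
  by_contra! hpos
  have := mul_pos (zero_lt_one.trans_le hlam) hpos
  linarith
end

section
/- Let d ≥ 2. Let M ∈ ℝ^{d×d} be a symmetric positive-definite matrix with orthonormal eigenbasis v_1, …, v_d ∈ ℝ^d and corresponding eigenvalues λ_1 ≥ λ_2 ≥ … ≥ λ_d > 0. Let β > 0, α > 0 and b ≥ 0 satisfy β²/λ_d ≥ α, and let r̂ ∈ ℝ^d satisfy ‖r̂‖_2 ≤ b. Let z_1, …, z_d be independent standard Gaussian random variables and define the random vector r̃ := r̂ + β Σ_{j=1}^d λ_j^{−1/2} z_j v_j (so that r̃ has the Gaussian law N(r̂, β² M^{−1})). Then for every a > 0: ℙ( r̃ · v_d ≥ a · max_{1 ≤ j ≤ d−1} |r̃ · v_j| ) ≥ c(a) and ℙ( r̃ · v_d ≤ −a · max_{1 ≤ j ≤ d−1} |r̃ · v_j| ) ≥ c(a), where c(a) := ℙ( z_d ≥ b(1+a)/√α + a · max_{1 ≤ j ≤ d−1} |z_j| ) > 0. -/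
open MeasureTheory ProbabilityTheory Matrix Finset

/-- A standard Gaussian vector with i.i.d. coordinates is symmetric. -/
lemma measurePreserving_neg_pi_gaussianReal {ι : Type*} [Fintype ι] :
    MeasurePreserving (MeasurableEquiv.neg (ι → ℝ))
      (Measure.pi fun _ : ι => gaussianReal 0 1) (Measure.pi fun _ : ι => gaussianReal 0 1) := by
  refine measurePreserving_pi (f := fun _ x => -x) _ _ fun _ => ⟨measurable_neg, ?_⟩
  simpa using gaussianReal_map_neg (μ := 0) (v := 1)

/-- The affine cone event for a standard Gaussian vector has positive probability. -/
lemma pi_gaussianReal_cone_pos {ι : Type*} [Fintype ι] {s : Finset ι} (hs : s.Nonempty)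
    {k : ι} (hk : k ∉ s) (C a : ℝ) :
    0 < (Measure.pi fun _ : ι => gaussianReal 0 1)
      {z : ι → ℝ | C + a * (s.sup' hs fun j => |z j|) ≤ z k} := by
  classical
  have : (gaussianReal 0 1).IsOpenPosMeasure :=
    (gaussianReal_absolutelyContinuous' 0 one_ne_zero).isOpenPosMeasure
  have hopen : IsOpen {z : ι → ℝ | C + a * (s.sup' hs fun j => |z j|) < z k} := by
    refine isOpen_lt (continuous_const.add (continuous_const.mul ?_)) (continuous_apply k)
    exact Continuous.finset_sup'_apply hs fun i _ => (continuous_apply i).abs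
  refine (hopen.measure_pos _ ⟨Pi.single k (C + 1), ?_⟩).trans_le
    (measure_mono (Set.ofPred_subset_ofPred.2 fun _ => le_of_lt))
  have h0 : (s.sup' hs fun j => |(Pi.single k (C + 1) : ι → ℝ) j|) = 0 := by
    rw [Finset.sup'_congr hs rfl (g := fun _ => (0 : ℝ)), Finset.sup'_const]
    intro j hj
    rw [Pi.single_eq_of_ne (ne_of_mem_of_not_mem hj hk), abs_zero]
  simp [h0]

/-- If `y` is within `b` of a coordinatewise rescaling of `z` whose largest factor, at `k`, is at
least `σ`, then a large enough `z k` makes `y k` dominate the remaining coordinates of `y`. -/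
lemma mul_sup'_abs_le_of_scaled_perturbation {ι : Type*} {s : Finset ι} (hs : s.Nonempty) {k : ι}
    {y z c : ι → ℝ} {a b σ : ℝ} (ha : 0 ≤ a) (hb : 0 ≤ b) (hσ : 0 < σ)
    (hy : ∀ j, |y j - c j * z j| ≤ b) (hc : ∀ j, 0 ≤ c j) (hck : ∀ j, c j ≤ c k) (hσk : σ ≤ c k)
    (hz : b * (1 + a) / σ + a * (s.sup' hs fun j => |z j|) ≤ z k) :
    a * (s.sup' hs fun j => |y j|) ≤ y k := by
  set m := s.sup' hs fun j => |z j| with hm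
  have hsup : (s.sup' hs fun j => |y j|) ≤ b + c k * m := by
    refine Finset.sup'_le hs _ fun j hj => ?_
    have hzm : |z j| ≤ m := Finset.le_sup' (fun j => |z j|) hj
    calc |y j| = |(y j - c j * z j) + c j * z j| := by ring_nf
      _ ≤ |y j - c j * z j| + |c j * z j| := abs_add_le _ _
      _ ≤ b + c k * m := by
        rw [abs_mul, abs_of_nonneg (hc j)]
        exact add_le_add (hy j)
          (mul_le_mul (hck j) hzm (abs_nonneg _) (hc k))
  have hC : b * (1 + a) ≤ c k * (b * (1 + a) / σ) := by
    calc b * (1 + a) = σ * (b * (1 + a) / σ) := by field_simp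
      _ ≤ c k * (b * (1 + a) / σ) := by gcongr
  have h1 := mul_le_mul_of_nonneg_left hz (hc k)
  have h2 := (abs_le.1 (hy k)).1
  have h3 := mul_le_mul_of_nonneg_left hsup ha
  linarith

/-- Cauchy–Schwarz against a unit vector. -/
lemma abs_dotProduct_le_of_unit {ι : Type*} [Fintype ι] {x u : ι → ℝ} (hu : u ⬝ᵥ u = 1) :
    |x ⬝ᵥ u| ≤ Real.sqrt (∑ j, x j ^ 2) := by
  refine Real.abs_le_sqrt ?_
  have hu' : ∑ j, u j ^ 2 = 1 := by simpa [dotProduct, sq] using hu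
  simpa [dotProduct, hu'] using Finset.sum_mul_sq_le_sq_mul_sq Finset.univ x u

/-- Coordinates of an affine combination of an orthonormal family. -/
lemma add_smul_sum_smul_dotProduct {ι κ : Type*} [Fintype ι] [DecidableEq ι] [Fintype κ]
    {v : ι → κ → ℝ} (hv : ∀ i j, v i ⬝ᵥ v j = if i = j then (1 : ℝ) else 0)
    (x : κ → ℝ) (β : ℝ) (w : ι → ℝ) (k : ι) :
    (x + β • ∑ j, w j • v j) ⬝ᵥ v k = x ⬝ᵥ v k + β * w k := by
  simp [add_dotProduct, smul_dotProduct, sum_dotProduct, hv]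

/-- alignment of Thompson samples with the minimal eigenvector. Given a
symmetric positive-definite `M` with orthonormal eigenbasis `v j` and antitone positive
eigenvalues `lam j`, `β² / λ_d ≥ α`, `‖r̂‖₂ ≤ b`, and the Gaussian sample
`r̃ = r̂ + β ∑ j λ_j^{−1/2} z_j v_j` with `z` i.i.d. standard Gaussian, the events
`r̃ · v_d ≥ a · max_{j<d} |r̃ · v_j|` and `r̃ · v_d ≤ −a · max_{j<d} |r̃ · v_j|` each
have probability at least `c(a) := ℙ(z_d ≥ b(1+a)/√α + a max_{j<d} |z_j|) > 0`. -/
theorem thompson_sample_alignment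
    (d : ℕ) (hd : 2 ≤ d)
    (M : Matrix (Fin d) (Fin d) ℝ) (hM : M.PosDef)
    (v : Fin d → (Fin d → ℝ)) (lam : Fin d → ℝ)
    (horth : ∀ i j, v i ⬝ᵥ v j = if i = j then (1:ℝ) else 0)
    (heig : ∀ j, M *ᵥ v j = lam j • v j)
    (hmono : Antitone lam)
    (hpos : 0 < lam ⟨d - 1, by omega⟩)
    (β α b : ℝ) (hβ : 0 < β) (hα : 0 < α) (hb : 0 ≤ b)
    (hcond : α ≤ β ^ 2 / lam ⟨d - 1, by omega⟩)
    (rhat : Fin d → ℝ) (hrhat : Real.sqrt (∑ j, rhat j ^ 2) ≤ b)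
    (a : ℝ) (ha : 0 < a) :
    letI last : Fin d := ⟨d - 1, by omega⟩
    letI hne : (Finset.univ.erase last).Nonempty := by
      rw [← Finset.card_pos, Finset.card_erase_of_mem (Finset.mem_univ _),
        Finset.card_univ, Fintype.card_fin]
      omega
    letI μ := Measure.pi fun _ : Fin d => gaussianReal 0 1
    letI rt : (Fin d → ℝ) → (Fin d → ℝ) :=
      fun z => rhat + β • ∑ j, ((Real.sqrt (lam j))⁻¹ * z j) • v j
    letI c := μ {z : Fin d → ℝ |
      b * (1 + a) / Real.sqrt α +
        a * ((Finset.univ.erase last).sup' hne fun j => |z j|) ≤ z last}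
    0 < c ∧
    c ≤ μ {z : Fin d → ℝ |
      a * ((Finset.univ.erase last).sup' hne fun j => |rt z ⬝ᵥ v j|) ≤ rt z ⬝ᵥ v last} ∧
    c ≤ μ {z : Fin d → ℝ |
      rt z ⬝ᵥ v last ≤
        -(a * ((Finset.univ.erase last).sup' hne fun j => |rt z ⬝ᵥ v j|))} := by
  set last : Fin d := ⟨d - 1, by omega⟩ with hlast_def
  have hne : (Finset.univ.erase last).Nonempty :=
    ⟨⟨0, by omega⟩, by simp [hlast_def, Fin.ext_iff]; omega⟩
  set rt : (Fin d → ℝ) → (Fin d → ℝ) :=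
    fun z => rhat + β • ∑ j, ((Real.sqrt (lam j))⁻¹ * z j) • v j
  have hlam : ∀ j, lam last ≤ lam j := fun j => hmono (Fin.le_def.2 (by simp [hlast_def]; omega))
  have hcoord : ∀ z j, rt z ⬝ᵥ v j = rhat ⬝ᵥ v j + β * ((Real.sqrt (lam j))⁻¹ * z j) :=
    fun z j => add_smul_sum_smul_dotProduct horth rhat β _ j
  have hy : ∀ z j, |rt z ⬝ᵥ v j - β * (Real.sqrt (lam j))⁻¹ * z j| ≤ b := fun z j => by
    rw [hcoord, mul_assoc, add_sub_cancel_right]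
    exact (abs_dotProduct_le_of_unit (by simp [horth])).trans hrhat
  have hc : ∀ j, 0 ≤ β * (Real.sqrt (lam j))⁻¹ := fun j => by positivity
  have hck : ∀ j, β * (Real.sqrt (lam j))⁻¹ ≤ β * (Real.sqrt (lam last))⁻¹ := fun j => by
    have := Real.sqrt_pos.2 hpos
    gcongr
    exact hlam j
  have hσk : Real.sqrt α ≤ β * (Real.sqrt (lam last))⁻¹ := by
    rw [← div_eq_mul_inv, ← Real.sqrt_sq hβ.le, ← Real.sqrt_div (sq_nonneg β)]
    exact Real.sqrt_le_sqrt hcond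
  have hσ := Real.sqrt_pos.2 hα
  refine ⟨pi_gaussianReal_cone_pos hne (by simp) _ _, measure_mono fun z hz =>
    mul_sup'_abs_le_of_scaled_perturbation hne ha.le hb hσ (hy z) hc hck hσk hz, ?_⟩
  refine (measurePreserving_neg_pi_gaussianReal.measure_preimage_equiv _).symm.trans_le
    (measure_mono fun z hz => ?_)
  have hneg : ∀ j, |(-(rt z ⬝ᵥ v j)) - β * (Real.sqrt (lam j))⁻¹ * (-z) j| ≤ b := fun j => by
    rw [Pi.neg_apply, mul_neg, ← neg_sub', abs_neg]
    exact hy z j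
  have := mul_sup'_abs_le_of_scaled_perturbation hne ha.le hb hσ hneg hc hck hσk hz
  simp only [abs_neg] at this
  exact le_neg_of_le_neg this
end
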